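/- Let σ1 be the Tribonacci substitution on {a,b,c} (σ1(a)=ab, σ1(b)=ac, σ1(c)=a) and σ2 the flipped Tribonacci substitution (σ2(a)=ab, σ2(b)=ca, σ2(c)=a). Let φ be the substitution on the 11-letter alphabet {A,B,C,D,E,F,G,H,I,J,K} given by φ(A)=AB, φ(B)=C, φ(C)=AD, φ(D)=AE, φ(E)=F, φ(F)=ADDGA, φ(G)=AH, φ(H)=ID, φ(I)=ADJ, φ(J)=AHK, φ(K)=IDGA, and let p1, p2 be the monoid morphisms to words over {a,b,c} given by p1(A)=a, p1(B)=b, p1(C)=ac, p1(D)=ba, p1(E)=cab, p1(F)=aabac, p1(G)=cab, p1(H)=abac, p1(I)=abaca, p1(J)=cabaab, p1(K)=ababac and p2(A)=a, p2(B)=b, p2(C)=ca, p2(D)=ab, p2(E)=bca, p2(F)=caaab, p2(G)=abc, p2(H)=bcaa, p2(I)=caaab, p2(J)=ababca, p2(K)=bcaaab. Then for every n ∈ ℕ, p1(φ^n(A)) = σ1^n(a) and p2(φ^n(A)) = σ2^n(a). -/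

import Mathlib

/- STATEMENT 8: The morphism φ on an 11-letter balanced-block alphabet
generates the fixed points of the Tribonacci and flipped Tribonacci
substitutions via the projections p1, p2. -/

namespace Stmt8

inductive ABC : Type
  | a | b | c
deriving DecidableEq

inductive L : Type
  | A | B | C | D | E | F | G | H | I | J | K
deriving DecidableEq

/-- Extension of a letter-to-word map to a morphism of free monoids. -/
def subst {α β : Type} (f : α → List β) (w : List α) : List β :=
  w.flatMap f

/-- The Tribonacci substitution. -/
def σ1 : ABC → List ABC
  | .a => [.a, .b]
  | .b => [.a, .c]
  | .c => [.a]

/-- The flipped Tribonacci substitution. -/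
def σ2 : ABC → List ABC
  | .a => [.a, .b]
  | .b => [.c, .a]
  | .c => [.a]

def φ : L → List L
  | .A => [.A, .B]
  | .B => [.C]
  | .C => [.A, .D]
  | .D => [.A, .E]
  | .E => [.F]
  | .F => [.A, .D, .D, .G, .A]
  | .G => [.A, .H]
  | .H => [.I, .D]
  | .I => [.A, .D, .J]
  | .J => [.A, .H, .K]
  | .K => [.I, .D, .G, .A]

def p1 : L → List ABC
  | .A => [.a]
  | .B => [.b]
  | .C => [.a, .c]
  | .D => [.b, .a]
  | .E => [.c, .a, .b]
  | .F => [.a, .a, .b, .a, .c]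
  | .G => [.c, .a, .b]
  | .H => [.a, .b, .a, .c]
  | .I => [.a, .b, .a, .c, .a]
  | .J => [.c, .a, .b, .a, .a, .b]
  | .K => [.a, .b, .a, .b, .a, .c]

def p2 : L → List ABC
  | .A => [.a]
  | .B => [.b]
  | .C => [.c, .a]
  | .D => [.a, .b]
  | .E => [.b, .c, .a]
  | .F => [.c, .a, .a, .a, .b]
  | .G => [.a, .b, .c]
  | .H => [.b, .c, .a, .a]
  | .I => [.c, .a, .a, .a, .b]
  | .J => [.a, .b, .a, .b, .c, .a]
  | .K => [.b, .c, .a, .a, .a, .b]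

theorem subst_subst {α β γ : Type} (f : α → List β) (g : β → List γ) (w : List α) :
    subst g (subst f w) = subst (fun x => subst g (f x)) w :=
  List.flatMap_assoc

/-- A projection that intertwines two substitutions on letters intertwines all their iterates. -/
theorem semiconj_subst {α β : Type} {f : α → List α} {s : β → List β} {p : α → List β}
    (h : ∀ x, subst p (f x) = subst s (p x)) :
    Function.Semiconj (subst p) (subst f) (subst s) := fun w => by
  rw [subst_subst, subst_subst, funext h]

theorem subst_p1_φ (x : L) : subst p1 (φ x) = subst σ1 (p1 x) := by
  cases x <;> rfl

theorem subst_p2_φ (x : L) : subst p2 (φ x) = subst σ2 (p2 x) := by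
  cases x <;> rfl

theorem phi_generates_common_points :
    ∀ n : ℕ,
      subst p1 ((subst φ)^[n] [L.A]) = (subst σ1)^[n] [ABC.a] ∧
      subst p2 ((subst φ)^[n] [L.A]) = (subst σ2)^[n] [ABC.a] := by
  intro n
  exact ⟨((semiconj_subst subst_p1_φ).iterate_right n) [L.A],
    ((semiconj_subst subst_p2_φ).iterate_right n) [L.A]⟩

end Stmt8
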